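/- Let p be a prime number, c = (c_k)_{k≥0} a bounded sequence of integers, and ξ = Σ_{k≥0} c_k p^k the corresponding p-adic number, assumed irrational. If there exist positive real numbers c₃ and δ with δ < 1 such that for arbitrarily large m the rational number x_m has a partial quotient greater than c₃ p^{δm}, then there exists c₄ > 0 such that for every real number N there exist nonzero integers a, b with |ab| > N and |bξ − a|_p < c₄ |ab|^{−1/(1−δ)}. -/

import Mathlib

/-- The rational number `x_m = c₀/p^m + c₁/p^{m-1} + ⋯ + c_{m-1}/p`. -/
noncomputable def xm (p : ℕ) (c : ℕ → ℤ) (m : ℕ) : ℚ :=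
  ∑ k ∈ Finset.range m, (c k : ℚ) / (p : ℚ) ^ (m - k)

namespace GenContFract

open GenContFract (of)

/-- The continuants of the continued fraction expansion of a rational number are integers. -/
theorem exists_int_contsAux (v : ℚ) (n : ℕ) :
    ∃ A B : ℤ, (of v).contsAux n = ⟨(A : ℚ), (B : ℚ)⟩ := by
  induction n using Nat.twoStepInduction with
  | zero => exact ⟨1, 0, by simp [zeroth_contAux_eq_one_zero]⟩
  | one => exact ⟨⌊v⌋, 1, by simp [first_contAux_eq_h_one]⟩
  | more n ih₀ ih₁ =>
    obtain ⟨A₀, B₀, h₀⟩ := ih₀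
    obtain ⟨A₁, B₁, h₁⟩ := ih₁
    cases hs : (of v).s.get? n with
    | none =>
      refine ⟨A₁, B₁, ?_⟩
      rw [← h₁]
      exact contsAux_stable_step_of_terminated hs
    | some gp =>
      obtain ⟨ha, z, hz⟩ := of_partNum_eq_one_and_exists_int_partDen_eq hs
      refine ⟨z * A₁ + A₀, z * B₁ + B₀, ?_⟩
      rw [contsAux_recurrence hs h₀ h₁, ha, hz]
      push_cast
      simp

/-- The denominators of the convergents are at least one. -/
theorem one_le_of_den (v : ℚ) (n : ℕ) : 1 ≤ (of v).dens n := by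
  induction n with
  | zero => simp [zeroth_den_eq_one]
  | succ n ih => exact ih.trans of_den_mono

/-- A partial quotient `q` of `v` yields a fraction `P / Q ≠ v` with `|v - P / Q| ≤ 1 / (q Q²)`. -/
theorem exists_int_approx_of_mem_partDens {v q : ℚ} (hq : q ∈ (of v).partDens) :
    ∃ P Q : ℤ, 0 < Q ∧ v * Q - P ≠ 0 ∧ q * (Q * |v * Q - P|) ≤ 1 := by
  obtain ⟨n, hn⟩ := Stream'.Seq.mem_iff_exists_get?.mp hq
  obtain ⟨gp, hgp, rfl⟩ := exists_s_b_of_partDen hn.symm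
  obtain ⟨ifp', hifp', hb⟩ := IntFractPair.exists_succ_get?_stream_of_gcf_of_get?_eq_some hgp
  obtain ⟨ifp, hifp, hfr, -⟩ := IntFractPair.succ_nth_stream_eq_some_iff.mp hifp'
  have hle : gp.b ≤ ifp.fr⁻¹ :=
    hb ▸ IntFractPair.succ_nth_stream_b_le_nth_stream_fr_inv hifp hifp'
  have hfr0 : 0 < ifp.fr⁻¹ :=
    inv_pos.mpr (lt_of_le_of_ne (IntFractPair.nth_stream_fr_nonneg hifp) (Ne.symm hfr))
  obtain ⟨P, Q, hPQ⟩ := exists_int_contsAux v (n + 1)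
  have hQ1 : (1 : ℚ) ≤ Q := by
    have := one_le_of_den v n
    rwa [den_eq_conts_b, nth_cont_eq_succ_nth_contAux, hPQ] at this
  have hpB : 0 ≤ ((of v).contsAux n).b := zero_le_of_contsAux_b
  have key := sub_convs_eq hifp
  simp only [hfr, if_false, conv_eq_num_div_den, num_eq_conts_a, den_eq_conts_b,
    nth_cont_eq_succ_nth_contAux, hPQ] at key
  set pB := ((of v).contsAux n).b
  have hQ0 : (0 : ℚ) < Q := by linarith
  have hD : 0 < ifp.fr⁻¹ * Q + pB := by positivity
  have hval : v * Q - P = (-1) ^ n / (ifp.fr⁻¹ * Q + pB) := by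
    have : v * Q - P = (v - P / Q) * Q := by field_simp
    rw [this, key, div_mul_eq_mul_div, mul_comm (Q : ℚ), mul_div_mul_right _ _ hQ0.ne']
  refine ⟨P, Q, by exact_mod_cast hQ0, ?_, ?_⟩
  · rw [hval]
    exact div_ne_zero (pow_ne_zero _ (by norm_num)) hD.ne'
  · rw [hval, abs_div, abs_pow, abs_neg, abs_one, one_pow, abs_of_pos hD, ← mul_assoc,
      mul_one_div, div_le_one hD]
    nlinarith

end GenContFract

/-- The `m`-th partial sum of a `p`-adic series with integer digits approximates it to within
`p ^ (-m)`. -/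
theorem Padic.norm_tsum_sub_sum_range_le (p : ℕ) [Fact p.Prime] (c : ℕ → ℤ) (m : ℕ) :
    ‖(∑' k : ℕ, (c k : ℚ_[p]) * (p : ℚ_[p]) ^ k) -
      ((∑ k ∈ Finset.range m, c k * (p : ℤ) ^ k : ℤ) : ℚ_[p])‖ ≤ ((p : ℝ) ^ m)⁻¹ := by
  have hp : 1 < (p : ℝ) := by exact_mod_cast (Fact.out : p.Prime).one_lt
  have hterm (k : ℕ) : ‖(c k : ℚ_[p]) * (p : ℚ_[p]) ^ k‖ ≤ ((p : ℝ)⁻¹) ^ k := by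
    rw [norm_mul, norm_pow, Padic.norm_p]
    exact mul_le_of_le_one_left (by positivity) (Padic.norm_int_le_one _)
  have hs : Summable fun k : ℕ => (c k : ℚ_[p]) * (p : ℚ_[p]) ^ k :=
    Summable.of_norm_bounded
      (summable_geometric_of_lt_one (by positivity) (inv_lt_one_of_one_lt₀ hp)) hterm
  rw [← hs.sum_add_tsum_nat_add m]
  push_cast
  rw [add_sub_cancel_left]
  refine IsUltrametricDist.norm_tsum_le_of_forall_le_of_nonneg (by positivity) fun k => ?_
  refine (hterm _).trans ?_
  rw [← inv_pow]
  exact pow_le_pow_of_le_one (by positivity) (inv_le_one_of_one_le₀ hp.le) (by omega)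

theorem xm_mul_pow (p : ℕ) [Fact p.Prime] (c : ℕ → ℤ) (m : ℕ) :
    xm p c m * (p : ℚ) ^ m = ((∑ k ∈ Finset.range m, c k * (p : ℤ) ^ k : ℤ) : ℚ) := by
  have hp : (p : ℚ) ≠ 0 := by exact_mod_cast (Fact.out : p.Prime).ne_zero
  rw [xm, Finset.sum_mul]
  push_cast
  refine Finset.sum_congr rfl fun k hk => ?_
  rw [div_mul_eq_mul_div, div_eq_iff (pow_ne_zero _ hp), mul_assoc, ← pow_add,
    Nat.add_sub_cancel' (Finset.mem_range.mp hk).le]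

/-- A partial quotient `q` of `x_m` yields nonzero integers `a`, `b` with `|ab| ≤ p ^ m / q` and
`|bξ - a|_p ≤ p ^ (-m)`. -/
theorem exists_int_padic_approx_of_mem_partDens (p : ℕ) [Fact p.Prime] (c : ℕ → ℤ) (m : ℕ) {q : ℚ}
    (hq : q ∈ (GenContFract.of (xm p c m)).partDens) :
    ∃ a b : ℤ, a ≠ 0 ∧ b ≠ 0 ∧ (q : ℝ) * ((|a * b| : ℤ) : ℝ) ≤ (p : ℝ) ^ m ∧
      ‖(b : ℚ_[p]) * (∑' k : ℕ, (c k : ℚ_[p]) * (p : ℚ_[p]) ^ k) - (a : ℚ_[p])‖ ≤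
        ((p : ℝ) ^ m)⁻¹ := by
  obtain ⟨P, Q, hQ, hne, hle⟩ := GenContFract.exists_int_approx_of_mem_partDens hq
  have hp : (0 : ℚ) < p := by exact_mod_cast (Fact.out : p.Prime).pos
  have hx := xm_mul_pow p c m
  have hnorm := Padic.norm_tsum_sub_sum_range_le p c m
  set S : ℤ := ∑ k ∈ Finset.range m, c k * (p : ℤ) ^ k
  set ξ : ℚ_[p] := ∑' k : ℕ, (c k : ℚ_[p]) * (p : ℚ_[p]) ^ k
  have ha : ((Q * S - P * (p : ℤ) ^ m : ℤ) : ℚ) = (xm p c m * Q - P) * (p : ℚ) ^ m := by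
    push_cast
    rw [← hx]
    ring
  refine ⟨Q * S - P * (p : ℤ) ^ m, Q, ?_, hQ.ne', ?_, ?_⟩
  · intro h
    rw [h, Int.cast_zero] at ha
    exact mul_ne_zero hne (pow_ne_zero _ hp.ne') ha.symm
  · have : q * ((|(Q * S - P * (p : ℤ) ^ m) * Q| : ℤ) : ℚ) ≤ (p : ℚ) ^ m := by
      have hQ' : (0 : ℚ) < Q := by exact_mod_cast hQ
      rw [Int.cast_abs, Int.cast_mul, ha, abs_mul, abs_mul, abs_of_pos hQ',
        abs_of_pos (pow_pos hp m)]
      calc q * (|xm p c m * Q - P| * (p : ℚ) ^ m * Q)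
          = q * (Q * |xm p c m * Q - P|) * (p : ℚ) ^ m := by ring
        _ ≤ 1 * (p : ℚ) ^ m := by gcongr
        _ = (p : ℚ) ^ m := one_mul _
    exact_mod_cast this
  · have hsplit : (Q : ℚ_[p]) * ξ - ((Q * S - P * (p : ℤ) ^ m : ℤ) : ℚ_[p]) =
        Q * (ξ - S) + P * (p : ℚ_[p]) ^ m := by
      push_cast
      ring
    rw [hsplit]
    refine (IsUltrametricDist.norm_add_le_max _ _).trans (max_le ?_ ?_)
    · rw [norm_mul]
      exact (mul_le_of_le_one_left (norm_nonneg _) (Padic.norm_int_le_one _)).trans hnorm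
    · rw [norm_mul, norm_pow, Padic.norm_p, inv_pow]
      exact mul_le_of_le_one_left (by positivity) (Padic.norm_int_le_one _)

/-- For irrational `ξ`, the linear forms `bξ - a` with bounded nonzero integers `a`, `b` are
eventually larger than `p ^ (-m)`. -/
theorem exists_forall_inv_pow_lt_norm (p : ℕ) [Fact p.Prime] {ξ : ℚ_[p]}
    (hirr : ∀ q : ℚ, ξ ≠ (q : ℚ_[p])) (N : ℝ) :
    ∃ M : ℕ, ∀ m, M ≤ m → ∀ a b : ℤ, a ≠ 0 → b ≠ 0 → ((|a * b| : ℤ) : ℝ) ≤ N →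
      ((p : ℝ) ^ m)⁻¹ < ‖(b : ℚ_[p]) * ξ - (a : ℚ_[p])‖ := by
  have hp : 1 < (p : ℝ) := by exact_mod_cast (Fact.out : p.Prime).one_lt
  have hlim : Filter.Tendsto (fun m : ℕ => ((p : ℝ) ^ m)⁻¹) Filter.atTop (nhds 0) :=
    (tendsto_pow_atTop_atTop_of_one_lt hp).inv_tendsto_atTop
  set S : Finset (ℤ × ℤ) := Finset.Icc (-⌊N⌋) ⌊N⌋ ×ˢ Finset.Icc (-⌊N⌋) ⌊N⌋
  have hev : ∀ᶠ m : ℕ in Filter.atTop, ∀ x ∈ S, x.2 ≠ 0 →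
      ((p : ℝ) ^ m)⁻¹ < ‖(x.2 : ℚ_[p]) * ξ - (x.1 : ℚ_[p])‖ := by
    refine (Filter.eventually_all_finset S).mpr fun x _ => ?_
    by_cases hx : x.2 = 0
    · simp [hx]
    have hpos : 0 < ‖(x.2 : ℚ_[p]) * ξ - (x.1 : ℚ_[p])‖ := by
      rw [norm_pos_iff, sub_ne_zero]
      intro h
      apply hirr ((x.1 : ℚ) / x.2)
      push_cast
      rw [eq_div_iff (by exact_mod_cast hx), mul_comm, h]
    filter_upwards [hlim.eventually_lt_const hpos] with m hm _ using hm
  obtain ⟨M, hM⟩ := Filter.eventually_atTop.mp hev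
  refine ⟨M, fun m hm a b ha hb hab => hM m hm (a, b) ?_ hb⟩
  have h := Int.le_floor.mpr hab
  rw [abs_mul] at h
  have ha1 := Int.one_le_abs ha
  have hb1 := Int.one_le_abs hb
  simp only [S, Finset.mem_product, Finset.mem_Icc, ← abs_le]
  constructor <;> nlinarith

theorem large_partial_quotients_imply_good_approximations (p : ℕ) [Fact p.Prime] (c : ℕ → ℤ)
    (hc : ∃ B : ℝ, ∀ k, |(c k : ℝ)| ≤ B)
    (ξ : ℚ_[p]) (hξ : ξ = ∑' k : ℕ, (c k : ℚ_[p]) * (p : ℚ_[p]) ^ k)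
    (hirr : ∀ q : ℚ, ξ ≠ (q : ℚ_[p]))
    (c₃ δ : ℝ) (hc₃ : 0 < c₃) (hδ : 0 < δ) (hδ1 : δ < 1)
    (hlarge : ∀ M : ℕ, ∃ m : ℕ, M ≤ m ∧
      ∃ q ∈ (GenContFract.of (xm p c m)).partDens, c₃ * (p : ℝ) ^ (δ * m) < (q : ℝ)) :
    ∃ c₄ : ℝ, 0 < c₄ ∧ ∀ N : ℝ, ∃ a b : ℤ, a ≠ 0 ∧ b ≠ 0 ∧
      N < ((|a * b| : ℤ) : ℝ) ∧
      ‖(b : ℚ_[p]) * ξ - (a : ℚ_[p])‖ < c₄ * ((|a * b| : ℤ) : ℝ) ^ (-(1 / (1 - δ))) := by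
  have hp : 0 < (p : ℝ) := by exact_mod_cast (Fact.out : p.Prime).pos
  have hδ' : 0 < 1 - δ := by linarith
  refine ⟨c₃ ^ (-(1 / (1 - δ))), by positivity, fun N => ?_⟩
  obtain ⟨M, hM⟩ := exists_forall_inv_pow_lt_norm p hirr N
  obtain ⟨m, hm, q, hq, hqlt⟩ := hlarge M
  obtain ⟨a, b, ha, hb, hab, hnorm⟩ := exists_int_padic_approx_of_mem_partDens p c m hq
  rw [← hξ] at hnorm
  refine ⟨a, b, ha, hb, ?_, hnorm.trans_lt ?_⟩
  · by_contra! h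
    exact (hM m hm a b ha hb h).not_ge hnorm
  · have hpos : (0 : ℝ) < ((|a * b| : ℤ) : ℝ) := by
      exact_mod_cast abs_pos.mpr (mul_ne_zero ha hb)
    set T : ℝ := ((|a * b| : ℤ) : ℝ)
    have hlt : c₃ * T < (p : ℝ) ^ ((1 - δ) * m) := by
      have h1 : c₃ * (p : ℝ) ^ (δ * m) * T < (p : ℝ) ^ m :=
        (mul_lt_mul_of_pos_right hqlt hpos).trans_le hab
      have h2 : (p : ℝ) ^ m = (p : ℝ) ^ ((1 - δ) * m) * (p : ℝ) ^ (δ * m) := by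
        rw [← Real.rpow_add hp, ← Real.rpow_natCast]
        congr 1
        ring
      rw [h2] at h1
      refine lt_of_mul_lt_mul_right (a := (p : ℝ) ^ (δ * m)) ?_ (by positivity)
      linarith
    have hexp : ((p : ℝ) ^ m)⁻¹ = ((p : ℝ) ^ ((1 - δ) * m)) ^ (-(1 / (1 - δ))) := by
      rw [← Real.rpow_mul hp.le, ← Real.rpow_natCast, ← Real.rpow_neg hp.le]
      congr 1
      field_simp
    rw [← Real.mul_rpow hc₃.le hpos.le, hexp]
    exact Real.rpow_lt_rpow_of_neg (by positivity) hlt (by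
      rw [neg_lt_zero]
      positivity)
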